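/- arXiv:1505.06229 — 2 statements merged into one kernel-verified Lean document; each statement's English description precedes it below -/
import Mathlib

section
/- For every n ≥ 1 and every x ∈ [−1/2, 1/2] one has (|ω_{n+1}| − α)·|q_n + x·q_{n−1}| ≤ (3/2)·|q_{n+1} + x·q_n|; equivalently, the function G_ω(x) = |(q_n + x·q_{n−1})/(q_{n+1} + x·q_n)| satisfies G_ω(x) ≤ (3/2)·1/(|ω_{n+1}| − α). -/
/-- The constant `α = (3 - √5) / 2` is a root of `X ^ 2 - 3 X + 1` lying in `[0.38, 0.382]`. -/
lemma nicf_alpha_props :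
    ((3 - Real.sqrt 5) / 2) ^ 2 = 3 * ((3 - Real.sqrt 5) / 2) - 1 ∧
      0.38 ≤ (3 - Real.sqrt 5) / 2 ∧ (3 - Real.sqrt 5) / 2 ≤ 0.382 := by
  have h5 : Real.sqrt 5 ^ 2 = 5 := Real.sq_sqrt (by norm_num)
  have hl : 2.236 ≤ Real.sqrt 5 := Real.le_sqrt_of_sq_le (by norm_num)
  have hu : Real.sqrt 5 ≤ 2.24 := Real.sqrt_le_iff.mpr (by norm_num)
  exact ⟨by linarith, by linarith, by linarith⟩

/-- The bound `|a| ≤ α |b|` propagates along the recursion `(a, b) ↦ (b, w b + a)`. -/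
lemma abs_le_mul_abs_mul_add {α w a b : ℝ} (hα : α ^ 2 = 3 * α - 1) (hα0 : 0 ≤ α)
    (hw : 3 ≤ |w|) (hab : |a| ≤ α * |b|) : |b| ≤ α * |w * b + a| := by
  have h : |w| * |b| - |a| ≤ |w * b + a| := by
    have := abs_sub_abs_le_abs_sub (w * b) (-a)
    rwa [abs_neg, sub_neg_eq_add, abs_mul] at this
  have h3 : 3 * |b| ≤ |w| * |b| := mul_le_mul_of_nonneg_right hw (abs_nonneg b)
  calc |b| = α * (3 * |b| - α * |b|) := by linear_combination |b| * hα
    _ ≤ α * |w * b + a| := mul_le_mul_of_nonneg_left (by linarith) hα0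

/-- Consecutive continuants satisfy `|q_n| ≤ α |q_{n+1}|`. -/
lemma nicf_abs_continuant_le (ω q : ℕ → ℤ)
    (hω : ∀ n, 1 ≤ n → 3 ≤ |ω n|)
    (hq0 : q 0 = 1) (hq1 : q 1 = ω 1)
    (hrec : ∀ n, 2 ≤ n → q n = ω n * q (n - 1) + q (n - 2)) (n : ℕ) :
    |(q n : ℝ)| ≤ (3 - Real.sqrt 5) / 2 * |(q (n + 1) : ℝ)| := by
  obtain ⟨hα, hl, -⟩ := nicf_alpha_props
  have hω' (m : ℕ) (hm : 1 ≤ m) : (3 : ℝ) ≤ |(ω m : ℝ)| := by exact_mod_cast hω m hm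
  induction n with
  | zero =>
    have := hω' 1 le_rfl
    simp only [zero_add, hq0, hq1, Int.cast_one, abs_one]
    nlinarith
  | succ k ih =>
    have hr : (q (k + 2) : ℝ) = ω (k + 2) * q (k + 1) + q k := by
      exact_mod_cast hrec (k + 2) (by omega)
    rw [show k + 1 + 1 = k + 2 from rfl, hr]
    exact abs_le_mul_abs_mul_add hα (by linarith) (hω' _ (by omega)) ih

/-- Lemma 3.4: with α = (3−√5)/2 and q the NICF continuant sequence of a digit sequence ω
with |ω_n| ≥ 3 for all n ≥ 1, for every n ≥ 1 and every x ∈ [−1/2, 1/2] one has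
(|ω_{n+1}| − α)·|q_n + x·q_{n−1}| ≤ (3/2)·|q_{n+1} + x·q_n|, i.e.
G_ω(x) = |(q_n + x·q_{n−1})/(q_{n+1} + x·q_n)| ≤ (3/2)·1/(|ω_{n+1}| − α). -/
theorem nicf_G_upper (ω q : ℕ → ℤ)
    (hω : ∀ n, 1 ≤ n → 3 ≤ |ω n|)
    (hq0 : q 0 = 1) (hq1 : q 1 = ω 1)
    (hrec : ∀ n, 2 ≤ n → q n = ω n * q (n - 1) + q (n - 2)) :
    ∀ n, 1 ≤ n → ∀ x ∈ Set.Icc (-(1 : ℝ) / 2) (1 / 2),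
      ((|ω (n + 1)| : ℝ) - (3 - Real.sqrt 5) / 2) * |(q n : ℝ) + x * q (n - 1)|
        ≤ (3 / 2) * |(q (n + 1) : ℝ) + x * q n| := by
  intro n hn x hx
  obtain ⟨m, rfl⟩ : ∃ m, n = m + 1 := ⟨n - 1, by omega⟩
  have hab := nicf_abs_continuant_le ω q hω hq0 hq1 hrec m
  have hr : (q (m + 2) : ℝ) = ω (m + 2) * q (m + 1) + q m := by
    exact_mod_cast hrec (m + 2) (by omega)
  have hw : (3 : ℝ) ≤ |(ω (m + 2) : ℝ)| := by exact_mod_cast hω (m + 2) (by omega)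
  obtain ⟨-, hl, hu⟩ := nicf_alpha_props
  rw [show m + 1 + 1 = m + 2 from rfl, add_tsub_cancel_right, hr]
  generalize (3 - Real.sqrt 5) / 2 = α at *
  generalize (q (m + 1) : ℝ) = b at *
  generalize (q m : ℝ) = a at *
  generalize (ω (m + 2) : ℝ) = w at *
  have hx' : |x| ≤ 1 / 2 := abs_le.mpr ⟨by linarith [hx.1], hx.2⟩
  have hb := abs_nonneg b
  have hupper : |b + x * a| ≤ (1 + α / 2) * |b| := by
    have h := abs_add_le b (x * a)
    rw [abs_mul] at h
    have := mul_le_mul_of_nonneg_right hx' (abs_nonneg a)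
    linarith
  have hlower : (|w| - α - 1 / 2) * |b| ≤ |w * b + a + x * b| := by
    have h := abs_sub_abs_le_abs_sub (w * b) (-(a + x * b))
    rw [abs_neg, sub_neg_eq_add, abs_mul, ← add_assoc] at h
    have h' := abs_add_le a (x * b)
    rw [abs_mul] at h'
    have := mul_le_mul_of_nonneg_right hx' hb
    linarith
  have hcoef : (|w| - α) * (1 + α / 2) ≤ 3 / 2 * (|w| - α - 1 / 2) := by nlinarith
  calc (|w| - α) * |b + x * a| ≤ (|w| - α) * ((1 + α / 2) * |b|) :=
        mul_le_mul_of_nonneg_left hupper (by linarith)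
    _ = (|w| - α) * (1 + α / 2) * |b| := by ring
    _ ≤ 3 / 2 * (|w| - α - 1 / 2) * |b| := mul_le_mul_of_nonneg_right hcoef hb
    _ ≤ 3 / 2 * |w * b + a + x * b| := by linarith
end

section
/- The nearest integer continued fraction system restricted to digits of absolute value at least 3 has full Hausdorff dimension spectrum: {dim_H(J_G) : G ⊆ F} = [0, dim_H(J_F)], i.e. for every real t with 0 ≤ t ≤ dim_H(J_F) there exists a subset G ⊆ F such that dim_H(J_G) = t. -/
open scoped ENNReal
/-- The inverse branch φ_b(x) = 1/(b+x) of the nearest integer continued fraction map. -/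
noncomputable def nicfPhi (b : ℤ) : ℝ → ℝ := fun x => 1 / ((b : ℝ) + x)

/-- Composition φ_{w_1} ∘ ⋯ ∘ φ_{w_m} coded by a finite word w. -/
noncomputable def nicfComp (w : List ℤ) : ℝ → ℝ :=
  w.foldr (fun b f => nicfPhi b ∘ f) id

/-- The alphabet F = {b ∈ ℤ : |b| ≥ 3}. -/
def nicfF : Set ℤ := {b | 3 ≤ |b|}

/-- The limit set J_G of the system {φ_b}_{b ∈ G}: all limits
lim_n φ_{ω_1}∘⋯∘φ_{ω_n}(0) over sequences ω with all letters in G. -/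
noncomputable def nicfLimitSet (G : Set ℤ) : Set ℝ :=
  {x | ∃ ω : ℕ → ℤ, (∀ n, ω n ∈ G) ∧
    Filter.Tendsto (fun n => nicfComp ((List.range n).map ω) 0) Filter.atTop (nhds x)}

/-! ### Geometry of the inverse branches -/

/-- The denominator of the Möbius map `nicfComp w`, whose derivative at `x` is
`± (nicfDen w x)⁻²`. -/
noncomputable def nicfDen : List ℤ → ℝ → ℝ
  | [], _ => 1
  | b :: w, x => ((b : ℝ) + nicfComp w x) * nicfDen w x

lemma nicfComp_nil (x : ℝ) : nicfComp [] x = x := rfl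

lemma nicfComp_cons (b : ℤ) (w : List ℤ) (x : ℝ) :
    nicfComp (b :: w) x = 1 / ((b : ℝ) + nicfComp w x) := rfl

lemma nicfComp_append (u v : List ℤ) (x : ℝ) :
    nicfComp (u ++ v) x = nicfComp u (nicfComp v x) := by
  induction u with
  | nil => rfl
  | cons b u ih => rw [List.cons_append, nicfComp_cons, nicfComp_cons, ih]

lemma nicfDen_append (u v : List ℤ) (x : ℝ) :
    nicfDen (u ++ v) x = nicfDen u (nicfComp v x) * nicfDen v x := by
  induction u with
  | nil => simp [nicfDen]
  | cons b u ih => simp only [List.cons_append, nicfDen, ih, nicfComp_append]; ring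

lemma three_le_abs_cast {b : ℤ} (hb : b ∈ nicfF) : (3 : ℝ) ≤ |(b : ℝ)| := by
  have h : (3 : ℤ) ≤ |b| := hb
  exact_mod_cast h

lemma le_abs_digit_add {b : ℤ} (hb : b ∈ nicfF) {x : ℝ} (hx : |x| ≤ 2 / 5) :
    13 / 5 ≤ |(b : ℝ) + x| := by
  have h := three_le_abs_cast hb
  have h' := abs_sub_abs_le_abs_sub (b : ℝ) (-x)
  rw [abs_neg, sub_neg_eq_add] at h'
  linarith

lemma digit_add_ne_zero {b : ℤ} (hb : b ∈ nicfF) {x : ℝ} (hx : |x| ≤ 2 / 5) :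
    (b : ℝ) + x ≠ 0 :=
  abs_pos.1 (by linarith [le_abs_digit_add hb hx])

lemma abs_one_div_digit_add_le {b : ℤ} (hb : b ∈ nicfF) {x : ℝ} (hx : |x| ≤ 2 / 5) :
    |1 / ((b : ℝ) + x)| ≤ 2 / 5 := by
  have h := le_abs_digit_add hb hx
  rw [abs_div, abs_one, div_le_iff₀ (by linarith)]
  linarith

lemma abs_nicfComp_le {w : List ℤ} (hw : ∀ b ∈ w, b ∈ nicfF) {x : ℝ} (hx : |x| ≤ 2 / 5) :
    |nicfComp w x| ≤ 2 / 5 := by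
  induction w with
  | nil => exact hx
  | cons b w ih =>
    rw [List.forall_mem_cons] at hw
    exact abs_one_div_digit_add_le hw.1 (ih hw.2)

lemma two_pow_le_abs_nicfDen {w : List ℤ} (hw : ∀ b ∈ w, b ∈ nicfF) {x : ℝ}
    (hx : |x| ≤ 2 / 5) : 2 ^ w.length ≤ |nicfDen w x| := by
  induction w with
  | nil => simp [nicfDen]
  | cons b w ih =>
    rw [List.forall_mem_cons] at hw
    have h := le_abs_digit_add hw.1 (abs_nicfComp_le hw.2 hx)
    rw [nicfDen, abs_mul, List.length_cons, pow_succ']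
    have := ih hw.2
    gcongr
    linarith

lemma nicfDen_ne_zero {w : List ℤ} (hw : ∀ b ∈ w, b ∈ nicfF) {x : ℝ} (hx : |x| ≤ 2 / 5) :
    nicfDen w x ≠ 0 :=
  abs_pos.1 ((pow_pos two_pos _).trans_le (two_pow_le_abs_nicfDen hw hx))

/-- The denominator is an affine function whose slope is small relative to its value at `0`. -/
lemma exists_nicfDen_eq {w : List ℤ} (hw : ∀ b ∈ w, b ∈ nicfF) :
    ∃ c : ℝ, |c| ≤ 2 / 5 ∧ ∀ x : ℝ, |x| ≤ 2 / 5 → nicfDen w x = nicfDen w 0 * (1 + c * x) := by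
  induction w using List.reverseRecOn with
  | nil => exact ⟨0, by norm_num, fun x _ => by simp [nicfDen]⟩
  | append_singleton w b ih =>
    have hb : b ∈ nicfF := hw b (by simp)
    obtain ⟨c, hc, h⟩ := ih fun a ha => hw a (by simp [ha])
    have h0 : |(0 : ℝ)| ≤ 2 / 5 := by norm_num
    have key : ∀ x : ℝ, |x| ≤ 2 / 5 →
        nicfDen (w ++ [b]) x = nicfDen w 0 * (b + x + c) := fun x hx => by
      rw [nicfDen_append, nicfComp_cons, nicfComp_nil, h _ (abs_one_div_digit_add_le hb hx)]
      have := digit_add_ne_zero hb hx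
      simp only [nicfDen, nicfComp_nil]
      field_simp
    refine ⟨1 / (b + c), abs_one_div_digit_add_le hb hc, fun x hx => ?_⟩
    rw [key x hx, key 0 h0]
    have := digit_add_ne_zero hb hc
    field_simp
    ring

lemma abs_nicfDen_bounds {w : List ℤ} (hw : ∀ b ∈ w, b ∈ nicfF) {x : ℝ} (hx : |x| ≤ 2 / 5) :
    21 / 25 * |nicfDen w 0| ≤ |nicfDen w x| ∧ |nicfDen w x| ≤ 29 / 25 * |nicfDen w 0| := by
  obtain ⟨c, hc, h⟩ := exists_nicfDen_eq hw
  have hcx : |c * x| ≤ 4 / 25 := by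
    rw [abs_mul]
    calc |c| * |x| ≤ 2 / 5 * (2 / 5) := by gcongr
      _ = 4 / 25 := by norm_num
  rw [abs_le] at hcx
  rw [h x hx, abs_mul, abs_of_pos (by linarith : 0 < 1 + c * x),
    mul_comm |nicfDen w 0|]
  constructor <;> gcongr <;> linarith

lemma abs_nicfComp_sub {w : List ℤ} (hw : ∀ b ∈ w, b ∈ nicfF) {x y : ℝ} (hx : |x| ≤ 2 / 5)
    (hy : |y| ≤ 2 / 5) :
    |nicfComp w x - nicfComp w y| = |x - y| / (|nicfDen w x| * |nicfDen w y|) := by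
  induction w with
  | nil => simp [nicfDen, nicfComp_nil]
  | cons b w ih =>
    rw [List.forall_mem_cons] at hw
    have hX := digit_add_ne_zero hw.1 (abs_nicfComp_le hw.2 hx)
    have hY := digit_add_ne_zero hw.1 (abs_nicfComp_le hw.2 hy)
    have h : 1 / ((b : ℝ) + nicfComp w x) - 1 / (b + nicfComp w y)
        = -(nicfComp w x - nicfComp w y) / ((b + nicfComp w x) * (b + nicfComp w y)) := by
      field_simp
      ring
    rw [nicfComp_cons, nicfComp_cons, h, abs_div, abs_neg, ih hw.2, nicfDen, nicfDen, abs_mul,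
      abs_mul, abs_mul, div_div]
    congr 1
    ring

lemma abs_nicfComp_sub_le {w : List ℤ} (hw : ∀ b ∈ w, b ∈ nicfF) {x y : ℝ} (hx : |x| ≤ 2 / 5)
    (hy : |y| ≤ 2 / 5) : |nicfComp w x - nicfComp w y| ≤ 2 / nicfDen w 0 ^ 2 := by
  have h0 : 0 < |nicfDen w 0| := abs_pos.2 (nicfDen_ne_zero hw (by norm_num))
  have hxy : |x - y| ≤ 4 / 5 := (abs_sub x y).trans (by linarith)
  have h1 := (abs_nicfDen_bounds hw hx).1
  have h2 := (abs_nicfDen_bounds hw hy).1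
  rw [abs_nicfComp_sub hw hx hy, ← sq_abs (nicfDen w 0)]
  calc |x - y| / (|nicfDen w x| * |nicfDen w y|)
      ≤ (4 / 5) / ((21 / 25 * |nicfDen w 0|) * (21 / 25 * |nicfDen w 0|)) := by gcongr
    _ = (4 / 5 / (21 / 25) ^ 2) / |nicfDen w 0| ^ 2 := by field_simp
    _ ≤ 2 / |nicfDen w 0| ^ 2 := by gcongr; norm_num

lemma le_abs_nicfComp_sub {w : List ℤ} (hw : ∀ b ∈ w, b ∈ nicfF) {x y : ℝ} (hx : |x| ≤ 2 / 5)
    (hy : |y| ≤ 2 / 5) :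
    |x - y| / 2 / nicfDen w 0 ^ 2 ≤ |nicfComp w x - nicfComp w y| := by
  have h0 : 0 < |nicfDen w 0| := abs_pos.2 (nicfDen_ne_zero hw (by norm_num))
  have hx0 : 0 < |nicfDen w x| := abs_pos.2 (nicfDen_ne_zero hw hx)
  have hy0 : 0 < |nicfDen w y| := abs_pos.2 (nicfDen_ne_zero hw hy)
  rw [abs_nicfComp_sub hw hx hy, ← sq_abs (nicfDen w 0), div_div]
  have h1 := (abs_nicfDen_bounds hw hx).2
  have h2 := (abs_nicfDen_bounds hw hy).2
  refine div_le_div_of_nonneg_left (abs_nonneg _) (by positivity) ?_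
  calc |nicfDen w x| * |nicfDen w y|
      ≤ (29 / 25 * |nicfDen w 0|) * (29 / 25 * |nicfDen w 0|) := by gcongr
    _ ≤ 2 * |nicfDen w 0| ^ 2 := by nlinarith

/-- Images of distinct digits stay apart, uniformly over bounded digits. -/
lemma le_abs_one_div_digit_sub {a b : ℤ} (ha : a ∈ nicfF) (hb : b ∈ nicfF) (hab : a ≠ b)
    {M : ℝ} (haM : |(a : ℝ)| ≤ M) (hbM : |(b : ℝ)| ≤ M) {x y : ℝ} (hx : |x| ≤ 2 / 5)
    (hy : |y| ≤ 2 / 5) : 1 / 5 / (M + 1) ^ 2 ≤ |1 / ((a : ℝ) + x) - 1 / (b + y)| := by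
  have hX := digit_add_ne_zero ha hx
  have hY := digit_add_ne_zero hb hy
  have h1 : (1 : ℝ) ≤ |(b : ℝ) - a| := by
    exact_mod_cast Int.one_le_abs (sub_ne_zero.2 hab.symm)
  have h2 : 1 / 5 ≤ |((b : ℝ) - a) + (y - x)| := by
    have h := abs_sub_abs_le_abs_sub ((b : ℝ) - a) (x - y)
    have h' := abs_sub x y
    rw [show (b : ℝ) - a - (x - y) = b - a + (y - x) by ring] at h
    linarith
  have h3 : |(a : ℝ) + x| ≤ M + 1 := (abs_add_le _ _).trans (by linarith)
  have h4 : |(b : ℝ) + y| ≤ M + 1 := (abs_add_le _ _).trans (by linarith)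
  have h5 : 1 / ((a : ℝ) + x) - 1 / (b + y) = ((b - a) + (y - x)) / ((a + x) * (b + y)) := by
    field_simp
    ring
  have hX' := abs_pos.2 hX
  have hY' := abs_pos.2 hY
  have hM : 0 ≤ M + 1 := hX'.le.trans h3
  rw [h5, abs_div, abs_mul, sq]
  gcongr

/-! ### Sums over words -/

/-- The words of length `m` with letters in `G`. -/
def nicfWords (G : Set ℤ) (m : ℕ) : Set (List ℤ) := {w | w.length = m ∧ ∀ b ∈ w, b ∈ G}

/-- The sum of `f` over the words of length `m` with letters in `G`. -/
noncomputable def wordSum (G : Set ℤ) (m : ℕ) (f : List ℤ → ℝ≥0∞) : ℝ≥0∞ :=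
  ∑' w : nicfWords G m, f w

lemma wordSum_zero (G : Set ℤ) (f : List ℤ → ℝ≥0∞) : wordSum G 0 f = f [] := by
  have h : nicfWords G 0 = {[]} := by
    ext w
    simp only [nicfWords, List.length_eq_zero_iff, Set.mem_ofPred_eq, Set.mem_singleton_iff]
    exact ⟨fun h => h.1, fun h => ⟨h, by simp [h]⟩⟩
  rw [wordSum, h, tsum_singleton]

/-- Splitting off the first letter of a nonempty word. -/
def nicfWordsSuccEquiv (G : Set ℤ) (m : ℕ) : G × nicfWords G m ≃ nicfWords G (m + 1) where
  toFun p := ⟨p.1 :: p.2, by simp [p.2.2.1], List.forall_mem_cons.2 ⟨p.1.2, p.2.2.2⟩⟩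
  invFun w := (⟨w.1.head (List.ne_nil_of_length_eq_add_one w.2.1), w.2.2 _ (List.head_mem _)⟩,
    ⟨w.1.tail, by simp [w.2.1], fun b hb => w.2.2 b (List.mem_of_mem_tail hb)⟩)
  left_inv p := by simp
  right_inv w := by simp

lemma wordSum_succ (G : Set ℤ) (m : ℕ) (f : List ℤ → ℝ≥0∞) :
    wordSum G (m + 1) f = ∑' b : G, wordSum G m fun w => f (b :: w) := by
  simp only [wordSum]
  rw [← (nicfWordsSuccEquiv G m).tsum_eq]
  exact ENNReal.tsum_prod (f := fun (b : G) (w : nicfWords G m) => f (b :: w))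

lemma wordSum_le {G : Set ℤ} {m : ℕ} {f g : List ℤ → ℝ≥0∞}
    (h : ∀ w ∈ nicfWords G m, f w ≤ g w) : wordSum G m f ≤ wordSum G m g :=
  ENNReal.tsum_le_tsum fun w => h w w.2

lemma wordSum_mono_set {G H : Set ℤ} (h : G ⊆ H) (m : ℕ) (f : List ℤ → ℝ≥0∞) :
    wordSum G m f ≤ wordSum H m f :=
  ENNReal.tsum_mono_subtype f fun _ hw => ⟨hw.1, fun b hb => h (hw.2 b hb)⟩

lemma wordSum_const_mul (G : Set ℤ) (m : ℕ) (c : ℝ≥0∞) (f : List ℤ → ℝ≥0∞) :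
    wordSum G m (fun w => c * f w) = c * wordSum G m f :=
  ENNReal.tsum_mul_left

lemma wordSum_mul_const (G : Set ℤ) (m : ℕ) (c : ℝ≥0∞) (f : List ℤ → ℝ≥0∞) :
    wordSum G m (fun w => f w * c) = wordSum G m f * c :=
  ENNReal.tsum_mul_right

lemma wordSum_tsum_comm {ι : Type*} (G : Set ℤ) (m : ℕ) (f : ι → List ℤ → ℝ≥0∞) :
    wordSum G m (fun w => ∑' i, f i w) = ∑' i, wordSum G m (f i) :=
  ENNReal.tsum_comm

lemma wordSum_add (G : Set ℤ) (m n : ℕ) (f : List ℤ → ℝ≥0∞) :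
    wordSum G (m + n) f = wordSum G m fun u => wordSum G n fun v => f (u ++ v) := by
  induction m generalizing f with
  | zero => simp [wordSum_zero]
  | succ m ih =>
    rw [Nat.add_right_comm, wordSum_succ, wordSum_succ]
    exact tsum_congr fun b => ih _

/-- The sum of `f` over all words with letters in `G`. -/
noncomputable def totalSum (G : Set ℤ) (f : List ℤ → ℝ≥0∞) : ℝ≥0∞ := ∑' m, wordSum G m f

lemma totalSum_eq (G : Set ℤ) (f : List ℤ → ℝ≥0∞) :
    totalSum G f = f [] + ∑' b : G, totalSum G fun w => f (b :: w) := by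
  simp only [totalSum]
  rw [tsum_eq_zero_add' ENNReal.summable, wordSum_zero, ENNReal.tsum_comm]
  simp only [wordSum_succ]

lemma totalSum_le {G : Set ℤ} {f g : List ℤ → ℝ≥0∞}
    (h : ∀ w, (∀ b ∈ w, b ∈ G) → f w ≤ g w) : totalSum G f ≤ totalSum G g :=
  ENNReal.tsum_le_tsum fun _ => wordSum_le fun w hw => h w hw.2

lemma totalSum_mul_const (G : Set ℤ) (c : ℝ≥0∞) (f : List ℤ → ℝ≥0∞) :
    totalSum G (fun w => f w * c) = totalSum G f * c := by
  simp only [totalSum, wordSum_mul_const, ENNReal.tsum_mul_right]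

lemma tsum_insert_le {G : Set ℤ} (n : ℤ) (g : ℤ → ℝ≥0∞) :
    ∑' b : (insert n G : Set ℤ), g b ≤ g n + ∑' b : G, g b := by
  rw [Set.insert_eq]
  exact (ENNReal.tsum_union_le g {n} G).trans (by rw [tsum_singleton])

/-- If occurrences of the letter `n` are dominated by sums over the letters in `T`, then `n` may
be replaced by `T` in sums over words. -/
lemma wordSum_insert_le {H G A T : Set ℤ} (hGH : G ⊆ H) (hA : A ⊆ G) (hT : T ⊆ G)
    (hAT : Disjoint A T) {n : ℤ} (hn : n ∈ H) (m : ℕ) (f : List ℤ → ℝ≥0∞)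
    (hf : ∀ u v : List ℤ, (∀ b ∈ u, b ∈ H) → (∀ b ∈ v, b ∈ H) →
      f (u ++ n :: v) ≤ ∑' b : T, f (u ++ (b : ℤ) :: v)) :
    wordSum (insert n A) m f ≤ wordSum G m f := by
  induction m generalizing f with
  | zero => simp [wordSum_zero]
  | succ m ih =>
    have hsub : insert n A ⊆ H := Set.insert_subset hn (hA.trans hGH)
    rw [wordSum_succ, wordSum_succ]
    calc ∑' b : (insert n A : Set ℤ), wordSum (insert n A) m (fun w => f (b :: w))
        ≤ ∑' b : (insert n A : Set ℤ), wordSum G m (fun w => f (b :: w)) :=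
          ENNReal.tsum_le_tsum fun b => ih _ fun u v hu hv =>
            hf (b :: u) v (List.forall_mem_cons.2 ⟨hsub b.2, hu⟩) hv
      _ ≤ wordSum G m (fun w => f (n :: w)) + ∑' b : A, wordSum G m (fun w => f (b :: w)) :=
          tsum_insert_le n fun b => wordSum G m fun w => f (b :: w)
      _ ≤ wordSum G m (fun w => ∑' b : T, f (b :: w))
            + ∑' b : A, wordSum G m (fun w => f (b :: w)) := by
          gcongr
          exact wordSum_le fun w hw => hf [] w (by simp) fun b hb => hGH (hw.2 b hb)
      _ = ∑' b : (A ∪ T : Set ℤ), wordSum G m (fun w => f (b :: w)) := by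
          rw [wordSum_tsum_comm, add_comm, ENNReal.summable.tsum_union_disjoint
            (f := fun b => wordSum G m fun w => f (b :: w)) hAT ENNReal.summable]
      _ ≤ ∑' b : G, wordSum G m (fun w => f (b :: w)) :=
          ENNReal.tsum_mono_subtype (fun b => wordSum G m fun w => f (b :: w))
            (Set.union_subset hA hT)

/-- Decomposing words with letters in `insert n G` at the first occurrence of `n`. -/
lemma sum_wordSum_insert_le (G : Set ℤ) (n : ℤ) (M : ℕ) (f : List ℤ → ℝ≥0∞) :
    ∑ m ∈ Finset.range (M + 1), wordSum (insert n G) m f ≤ totalSum G f +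
      totalSum G fun u =>
        ∑ m ∈ Finset.range M, wordSum (insert n G) m fun v => f (u ++ n :: v) := by
  have hstep : ∀ (N : ℕ) (g : List ℤ → ℝ≥0∞),
      ∑ m ∈ Finset.range (N + 1), wordSum (insert n G) m g ≤
        (g [] + ∑' b : G, ∑ m ∈ Finset.range N, wordSum (insert n G) m fun w => g (b :: w)) +
          ∑ m ∈ Finset.range N, wordSum (insert n G) m fun w => g (n :: w) := fun N g => by
    rw [Finset.sum_range_succ', wordSum_zero, Summable.tsum_finsetSum fun _ _ => ENNReal.summable,
      add_assoc, add_comm (g []), ← Finset.sum_add_distrib]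
    gcongr with m
    rw [wordSum_succ, add_comm]
    exact tsum_insert_le n fun b => wordSum (insert n G) m fun w => g (b :: w)
  induction M generalizing f with
  | zero =>
    refine (hstep 0 f).trans ?_
    rw [totalSum_eq G f]
    simp [add_assoc]
  | succ M ih =>
    refine (hstep (M + 1) f).trans ?_
    rw [totalSum_eq G f, totalSum_eq G fun u => _]
    calc _ ≤ (f [] + ∑' b : G, (totalSum G (fun w => f (b :: w)) + totalSum G fun u =>
              ∑ m ∈ Finset.range (M + 1), wordSum (insert n G) m fun v =>
                f ((b : ℤ) :: u ++ n :: v))) +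
            ∑ m ∈ Finset.range (M + 1), wordSum (insert n G) m fun w => f (n :: w) := by
          gcongr with b
          refine (ih _).trans ?_
          gcongr
          refine totalSum_le fun u _ => ?_
          exact Finset.sum_le_sum_of_subset (Finset.range_subset_range.2 M.le_succ)
      _ = _ := by
          rw [ENNReal.tsum_add]
          simp only [List.nil_append]
          ring

/-! ### Contraction ratios and partition sums -/

/-- The contraction ratio of `nicfComp w` at `0`. -/
noncomputable def nicfRatio (w : List ℤ) : ℝ≥0∞ := ENNReal.ofReal (1 / nicfDen w 0 ^ 2)

lemma nicfRatio_nil : nicfRatio [] = 1 := by simp [nicfRatio, nicfDen]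

lemma nicfRatio_ne_top (w : List ℤ) : nicfRatio w ≠ ∞ := ENNReal.ofReal_ne_top

lemma nicfDen_append_zero_sq_bounds {u v : List ℤ} (hu : ∀ b ∈ u, b ∈ nicfF)
    (hv : ∀ b ∈ v, b ∈ nicfF) :
    nicfDen u 0 ^ 2 * nicfDen v 0 ^ 2 ≤ 2 * nicfDen (u ++ v) 0 ^ 2 ∧
      nicfDen (u ++ v) 0 ^ 2 ≤ 2 * (nicfDen u 0 ^ 2 * nicfDen v 0 ^ 2) := by
  obtain ⟨h1, h2⟩ := abs_nicfDen_bounds hu (abs_nicfComp_le hv (x := 0) (by norm_num))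
  rw [nicfDen_append, mul_pow, ← sq_abs (nicfDen u 0), ← sq_abs (nicfDen u (nicfComp v 0))]
  constructor
  · rw [← mul_assoc]
    gcongr
    nlinarith [abs_nonneg (nicfDen u 0)]
  · rw [← mul_assoc]
    gcongr
    nlinarith [abs_nonneg (nicfDen u 0), abs_nonneg (nicfDen u (nicfComp v 0))]

lemma nicfDen_zero_sq_pos {w : List ℤ} (hw : ∀ b ∈ w, b ∈ nicfF) : 0 < nicfDen w 0 ^ 2 :=
  sq_pos_of_ne_zero (nicfDen_ne_zero hw (by norm_num))

lemma nicfRatio_append_le {u v : List ℤ} (hu : ∀ b ∈ u, b ∈ nicfF) (hv : ∀ b ∈ v, b ∈ nicfF) :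
    nicfRatio (u ++ v) ≤ 2 * (nicfRatio u * nicfRatio v) := by
  have hu0 := nicfDen_zero_sq_pos hu
  have hv0 := nicfDen_zero_sq_pos hv
  rw [nicfRatio, nicfRatio, nicfRatio, ← ENNReal.ofReal_mul (by positivity),
    ← ENNReal.ofReal_ofNat, ← ENNReal.ofReal_mul (by norm_num)]
  refine ENNReal.ofReal_le_ofReal ?_
  have h := (nicfDen_append_zero_sq_bounds hu hv).1
  rw [one_div_mul_one_div, ← div_eq_mul_one_div, div_le_div_iff₀ (by nlinarith) (by positivity)]
  linarith

lemma nicfRatio_mul_le {u v : List ℤ} (hu : ∀ b ∈ u, b ∈ nicfF) (hv : ∀ b ∈ v, b ∈ nicfF) :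
    nicfRatio u * nicfRatio v ≤ 2 * nicfRatio (u ++ v) := by
  have hu0 := nicfDen_zero_sq_pos hu
  have hv0 := nicfDen_zero_sq_pos hv
  have h1 := (nicfDen_append_zero_sq_bounds hu hv).1
  have h2 := (nicfDen_append_zero_sq_bounds hu hv).2
  rw [nicfRatio, nicfRatio, nicfRatio, ← ENNReal.ofReal_mul (by positivity),
    ← ENNReal.ofReal_ofNat, ← ENNReal.ofReal_mul (by norm_num)]
  refine ENNReal.ofReal_le_ofReal ?_
  rw [one_div_mul_one_div, ← div_eq_mul_one_div, div_le_div_iff₀ (by positivity) (by nlinarith)]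
  linarith

lemma nicfRatio_le_pow {w : List ℤ} (hw : ∀ b ∈ w, b ∈ nicfF) :
    nicfRatio w ≤ (1 / 4) ^ w.length := by
  have h := two_pow_le_abs_nicfDen hw (x := 0) (by norm_num)
  have h4 : (1 / 4 : ℝ≥0∞) = ENNReal.ofReal (1 / 4) := by
    rw [ENNReal.ofReal_div_of_pos (by norm_num)]; simp
  rw [h4, ← ENNReal.ofReal_pow (by norm_num), nicfRatio]
  refine ENNReal.ofReal_le_ofReal ?_
  rw [one_div_pow, ← sq_abs]
  refine one_div_le_one_div_of_le (by positivity) ?_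
  calc (4 : ℝ) ^ w.length = (2 ^ w.length) ^ 2 := by rw [← pow_mul, mul_comm, pow_mul]; norm_num
    _ ≤ _ := by gcongr

lemma nicfRatio_singleton (b : ℤ) : nicfRatio [b] = ENNReal.ofReal (1 / (b : ℝ) ^ 2) := by
  simp [nicfRatio, nicfDen, nicfComp_nil]

lemma two_rpow_le_two {t : ℝ} (ht : t ≤ 1) : (2 : ℝ≥0∞) ^ t ≤ 2 := by
  simpa using ENNReal.rpow_le_rpow_of_exponent_le (x := 2) one_le_two ht

lemma nicfRatio_append_rpow_le {t : ℝ} (ht0 : 0 ≤ t) (ht : t ≤ 1) {u v : List ℤ}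
    (hu : ∀ b ∈ u, b ∈ nicfF) (hv : ∀ b ∈ v, b ∈ nicfF) :
    nicfRatio (u ++ v) ^ t ≤ 2 * (nicfRatio u ^ t * nicfRatio v ^ t) := by
  refine (ENNReal.rpow_le_rpow (nicfRatio_append_le hu hv) ht0).trans ?_
  rw [ENNReal.mul_rpow_of_nonneg _ _ ht0, ENNReal.mul_rpow_of_nonneg _ _ ht0]
  gcongr
  exact two_rpow_le_two ht

lemma nicfRatio_mul_rpow_le {t : ℝ} (ht0 : 0 ≤ t) (ht : t ≤ 1) {u v : List ℤ}
    (hu : ∀ b ∈ u, b ∈ nicfF) (hv : ∀ b ∈ v, b ∈ nicfF) :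
    nicfRatio u ^ t * nicfRatio v ^ t ≤ 2 * nicfRatio (u ++ v) ^ t := by
  rw [← ENNReal.mul_rpow_of_nonneg _ _ ht0]
  refine (ENNReal.rpow_le_rpow (nicfRatio_mul_le hu hv) ht0).trans ?_
  rw [ENNReal.mul_rpow_of_nonneg _ _ ht0]
  gcongr
  exact two_rpow_le_two ht

/-- The partition sum of level `m` at exponent `t`. -/
noncomputable def nicfSum (G : Set ℤ) (t : ℝ) (m : ℕ) : ℝ≥0∞ :=
  wordSum G m fun w => nicfRatio w ^ t

lemma nicfSum_zero (G : Set ℤ) (t : ℝ) : nicfSum G t 0 = 1 := by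
  rw [nicfSum, wordSum_zero, nicfRatio_nil, ENNReal.one_rpow]

lemma nicfSum_mul_le {G : Set ℤ} (hG : G ⊆ nicfF) {t : ℝ} (ht0 : 0 ≤ t) (ht : t ≤ 1) (m n : ℕ) :
    nicfSum G t m * nicfSum G t n ≤ 2 * nicfSum G t (m + n) := by
  rw [nicfSum, nicfSum, nicfSum, wordSum_add, ← wordSum_mul_const, ← wordSum_const_mul]
  refine wordSum_le fun u hu => ?_
  rw [← wordSum_const_mul, ← wordSum_const_mul]
  exact wordSum_le fun v hv => nicfRatio_mul_rpow_le ht0 ht (fun b hb => hG (hu.2 b hb))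
    fun b hb => hG (hv.2 b hb)

/-- Partition sums that are bounded at all are bounded by `2`. -/
lemma nicfSum_le_two {G : Set ℤ} (hG : G ⊆ nicfF) {t : ℝ} (ht0 : 0 ≤ t) (ht : t ≤ 1) {C : ℝ≥0∞}
    (hC : C ≠ ∞) (h : ∀ m, nicfSum G t m ≤ C) (m : ℕ) : nicfSum G t m ≤ 2 := by
  by_contra! hm
  have h1 : 1 < nicfSum G t m / 2 := by
    rw [ENNReal.lt_div_iff_mul_lt (by simp) (by simp)]
    simpa using hm
  have hpow : ∀ k : ℕ, (nicfSum G t m / 2) ^ k ≤ nicfSum G t (k * m) := fun k => by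
    induction k with
    | zero => simp [nicfSum_zero]
    | succ k ih =>
      calc (nicfSum G t m / 2) ^ (k + 1)
          ≤ nicfSum G t (k * m) * (nicfSum G t m / 2) := by rw [pow_succ]; gcongr
        _ = nicfSum G t (k * m) * nicfSum G t m / 2 := (mul_div_assoc _ _ _).symm
        _ ≤ nicfSum G t ((k + 1) * m) := by
          refine ENNReal.div_le_of_le_mul' ?_
          rw [Nat.succ_mul]
          exact nicfSum_mul_le hG ht0 ht _ _
  have htop := ENNReal.tendsto_pow_atTop_nhds_top_iff.2 h1
  obtain ⟨k, hk⟩ := (htop.eventually (lt_mem_nhds hC.lt_top)).exists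
  exact absurd ((hpow k).trans (h _)) hk.not_ge

lemma nicfSum_le_of_finite {G : Set ℤ} {t : ℝ} {C : ℝ≥0∞} {m : ℕ}
    (h : ∀ A ⊆ G, A.Finite → nicfSum A t m ≤ C) : nicfSum G t m ≤ C := by
  classical
  rw [nicfSum, wordSum, ENNReal.tsum_eq_iSup_sum]
  refine iSup_le fun s => ?_
  let A : Set ℤ := ⋃ w ∈ s, {b | b ∈ w.1}
  have hA : A.Finite := s.finite_toSet.biUnion fun w _ => List.finite_toSet w.1
  have hAG : A ⊆ G := Set.iUnion₂_subset fun w _ b hb => w.2.2 b hb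
  refine le_trans ?_ (h A hAG hA)
  have hs : ∀ w ∈ s, w.1 ∈ nicfWords A m := fun w hw =>
    ⟨w.2.1, fun b hb => Set.mem_iUnion₂.2 ⟨w, hw, hb⟩⟩
  rw [← Finset.sum_attach, nicfSum, wordSum]
  have hinj : Function.Injective (fun w : s => (⟨w.1.1, hs _ w.2⟩ : nicfWords A m)) :=
    fun w w' hww => Subtype.ext (Subtype.ext (congrArg (fun x => x.1) hww))
  refine le_trans ?_ (ENNReal.tsum_comp_le_tsum_of_injective hinj
    fun w : nicfWords A m => nicfRatio w ^ t)
  rw [tsum_fintype]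
  rfl

lemma nicfSum_le_of_lt {G : Set ℤ} (hG : G ⊆ nicfF) {s t : ℝ} (hst : s < t)
    (h : ∀ m, nicfSum G s m ≤ 2) (m : ℕ) :
    nicfSum G t m ≤ ((1 / 4 : ℝ≥0∞) ^ (t - s)) ^ m * 2 := by
  refine le_trans ?_ (mul_le_mul_right (h m) _)
  rw [nicfSum, nicfSum, ← wordSum_const_mul]
  refine wordSum_le fun w hw => ?_
  have hwF : ∀ b ∈ w, b ∈ nicfF := fun b hb => hG (hw.2 b hb)
  have h0 : nicfRatio w ≠ 0 := by
    have := nicfDen_zero_sq_pos hwF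
    rw [nicfRatio, Ne, ENNReal.ofReal_eq_zero, not_le]
    positivity
  calc nicfRatio w ^ t = nicfRatio w ^ (t - s) * nicfRatio w ^ s := by
        rw [← ENNReal.rpow_add _ _ h0 (nicfRatio_ne_top w), sub_add_cancel]
    _ ≤ ((1 / 4 : ℝ≥0∞) ^ m) ^ (t - s) * nicfRatio w ^ s := by
        gcongr
        exact hw.1 ▸ nicfRatio_le_pow hwF
    _ = _ := by rw [← ENNReal.rpow_natCast_mul, mul_comm (m : ℝ), ENNReal.rpow_mul_natCast]

lemma quarter_rpow_lt_one {ε : ℝ} (hε : 0 < ε) : (1 / 4 : ℝ≥0∞) ^ ε < 1 :=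
  ENNReal.rpow_lt_one (by rw [one_div]; exact ENNReal.inv_lt_one.2 (by norm_num)) hε

lemma totalSum_ne_top_of_lt {G : Set ℤ} (hG : G ⊆ nicfF) {s t : ℝ} (hst : s < t)
    (h : ∀ m, nicfSum G s m ≤ 2) : totalSum G (fun w => nicfRatio w ^ t) ≠ ∞ := by
  refine ne_top_of_le_ne_top ?_ (ENNReal.tsum_le_tsum fun m => nicfSum_le_of_lt hG hst h m)
  rw [ENNReal.tsum_mul_right, ENNReal.tsum_geometric]
  refine ENNReal.mul_ne_top (ENNReal.inv_ne_top.2 ?_) (by simp)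
  exact (tsub_pos_of_lt (quarter_rpow_lt_one (sub_pos.2 hst))).ne'

/-- Adding a digit of sufficiently small ratio keeps the partition sums bounded. -/
lemma nicfSum_insert_le_two {G : Set ℤ} (hG : G ⊆ nicfF) {t : ℝ} (ht0 : 0 ≤ t) (ht : t ≤ 1)
    {n : ℤ} (hn : n ∈ nicfF) (hZ : totalSum G (fun w => nicfRatio w ^ t) ≠ ∞)
    (hsmall : totalSum G (fun w => nicfRatio w ^ t) * (8 * nicfRatio [n] ^ t) ≤ 1) (m : ℕ) :
    nicfSum (insert n G) t m ≤ 2 := by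
  set Z := totalSum G (fun w => nicfRatio w ^ t) with hZdef
  have hsub : insert n G ⊆ nicfF := Set.insert_subset hn hG
  have hU : ∀ M, ∑ m ∈ Finset.range M, nicfSum (insert n G) t m ≤ 2 * Z := fun M => by
    induction M with
    | zero => simp
    | succ M ih =>
      refine (sum_wordSum_insert_le G n M fun w => nicfRatio w ^ t).trans ?_
      rw [two_mul]
      gcongr
      calc totalSum G (fun u => ∑ m ∈ Finset.range M, wordSum (insert n G) m
              fun v => nicfRatio (u ++ n :: v) ^ t)
          ≤ totalSum G (fun u => nicfRatio u ^ t * (4 * nicfRatio [n] ^ t * (2 * Z))) := by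
            refine totalSum_le fun u hu => ?_
            refine le_trans ?_ (mul_le_mul_right (mul_le_mul_right ih _) _)
            rw [Finset.mul_sum, Finset.mul_sum]
            refine Finset.sum_le_sum fun m _ => ?_
            rw [nicfSum, ← wordSum_const_mul, ← wordSum_const_mul]
            refine wordSum_le fun v hv => ?_
            have huF : ∀ b ∈ u, b ∈ nicfF := fun b hb => hG (hu b hb)
            have hvF : ∀ b ∈ v, b ∈ nicfF := fun b hb => hsub (hv.2 b hb)
            calc nicfRatio (u ++ n :: v) ^ t
                ≤ 2 * (nicfRatio u ^ t * nicfRatio ([n] ++ v) ^ t) :=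
                  nicfRatio_append_rpow_le ht0 ht huF (List.forall_mem_cons.2 ⟨hn, hvF⟩)
              _ ≤ 2 * (nicfRatio u ^ t * (2 * (nicfRatio [n] ^ t * nicfRatio v ^ t))) := by
                  gcongr
                  exact nicfRatio_append_rpow_le ht0 ht (by simpa using hn) hvF
              _ = nicfRatio u ^ t * (4 * nicfRatio [n] ^ t * nicfRatio v ^ t) := by ring
        _ = Z * (8 * nicfRatio [n] ^ t) * Z := by
            rw [totalSum_mul_const, ← hZdef]
            ring
        _ ≤ Z := by simpa using mul_le_mul_left hsmall Z
  refine nicfSum_le_two hsub ht0 ht (C := 2 * Z) (ENNReal.mul_ne_top (by simp) hZ) (fun k => ?_) m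
  exact (Finset.single_le_sum (fun _ _ => zero_le) (Finset.self_mem_range_succ k)).trans (hU _)

/-! ### Replacing a digit by the tail behind it -/

lemma one_le_tsum_div_add_sq {y : ℝ} (hy : 2 ≤ y) :
    1 ≤ ∑' k : ℕ, ENNReal.ofReal (y ^ 2 / (y + (k + 1 : ℕ)) ^ 2) := by
  obtain ⟨M, hM⟩ := exists_nat_ge ((y + 1) ^ 2)
  have htel : ∀ N : ℕ, y ^ 2 * (1 / (y + 1) - 1 / (y + (N + 1 : ℕ))) ≤
      ∑ k ∈ Finset.range N, y ^ 2 / (y + (k + 1 : ℕ)) ^ 2 := fun N => by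
    induction N with
    | zero => simp
    | succ N ih =>
      rw [Finset.sum_range_succ]
      have hN : (0 : ℝ) ≤ N := N.cast_nonneg
      have h : 1 / (y + (N + 1 : ℕ)) - 1 / (y + (N + 1 + 1 : ℕ)) ≤ 1 / (y + (N + 1 : ℕ)) ^ 2 := by
        push_cast
        rw [div_sub_div _ _ (by positivity) (by positivity), div_le_div_iff₀ (by positivity)
          (by positivity)]
        nlinarith
      have h' := mul_le_mul_of_nonneg_left h (sq_nonneg y)
      rw [mul_one_div] at h'
      linarith
  refine le_trans ?_ (ENNReal.sum_le_tsum (Finset.range M))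
  rw [← ENNReal.ofReal_sum_of_nonneg fun _ _ => by positivity, ENNReal.one_le_ofReal]
  refine le_trans ?_ (htel M)
  have hM0 : (0 : ℝ) ≤ M := M.cast_nonneg
  push_cast
  rw [div_sub_div _ _ (by positivity) (by positivity), ← mul_div_assoc, one_le_div (by positivity)]
  nlinarith [mul_nonneg hM0 (by nlinarith : (0 : ℝ) ≤ y ^ 2 - y - 2)]

lemma nicfRatio_append_cons {u v : List ℤ} (hu : ∀ b ∈ u, b ∈ nicfF) (hv : ∀ b ∈ v, b ∈ nicfF) :
    ∃ s : ℝ, |s| ≤ 4 / 5 ∧ ∃ R : ℝ≥0∞, ∀ b ∈ nicfF,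
      nicfRatio (u ++ b :: v) = R * ENNReal.ofReal (1 / ((b : ℝ) + s) ^ 2) := by
  obtain ⟨c, hc, h⟩ := exists_nicfDen_eq hu
  have hy := abs_nicfComp_le hv (x := 0) (by norm_num)
  refine ⟨nicfComp v 0 + c, (abs_add_le _ _).trans (by linarith), nicfRatio u * nicfRatio v,
    fun b hb => ?_⟩
  have hby := digit_add_ne_zero hb hy
  have hden : nicfDen (u ++ b :: v) 0 =
      nicfDen u 0 * nicfDen v 0 * (b + (nicfComp v 0 + c)) := by
    rw [nicfDen_append, nicfComp_cons, h _ (abs_one_div_digit_add_le hb hy), nicfDen]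
    field_simp
    ring
  rw [nicfRatio, nicfRatio, nicfRatio, ← ENNReal.ofReal_mul (by positivity),
    ← ENNReal.ofReal_mul (by positivity), hden, mul_pow, mul_pow, one_div_mul_one_div,
    one_div_mul_one_div]

/-- The digits with the sign of `n` and larger absolute value. -/
def digitTail (n : ℤ) : Set ℤ := Set.range fun k : ℕ => n + n.sign * (k + 1 : ℕ)

lemma abs_digit_add_sign_mul {n : ℤ} (hn : n ≠ 0) (k : ℕ) :
    |n + n.sign * k| = |n| + k := by
  rcases hn.lt_or_gt with h | h
  · rw [Int.sign_eq_neg_one_of_neg h, abs_of_neg h, abs_of_nonpos (by lia)]; ring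
  · rw [Int.sign_eq_one_of_pos h, abs_of_pos h, abs_of_nonneg (by lia)]; ring

lemma ne_zero_of_mem_nicfF {n : ℤ} (hn : n ∈ nicfF) : n ≠ 0 := by
  rintro rfl
  simp [nicfF] at hn

lemma abs_lt_of_mem_digitTail {n b : ℤ} (hn : n ∈ nicfF) (hb : b ∈ digitTail n) : |n| < |b| := by
  obtain ⟨k, rfl⟩ := hb
  have := abs_digit_add_sign_mul (ne_zero_of_mem_nicfF hn) (k + 1)
  simp only
  lia

lemma digitTail_subset {n : ℤ} (hn : n ∈ nicfF) : digitTail n ⊆ nicfF := fun _ hb =>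
  (show (3 : ℤ) ≤ |n| from hn).trans (abs_lt_of_mem_digitTail hn hb).le

lemma digitTail_injective {n : ℤ} (hn : n ∈ nicfF) :
    Function.Injective fun k : ℕ => n + n.sign * (k + 1 : ℕ) := fun j k hjk => by
  have h := congrArg abs hjk
  simp only [abs_digit_add_sign_mul (ne_zero_of_mem_nicfF hn)] at h
  lia

lemma digit_add_sign_mul_add_sq {n : ℤ} (hn : n ∈ nicfF) {s : ℝ} (hs : |s| ≤ 4 / 5) (k : ℕ) :
    (((n + n.sign * k : ℤ) : ℝ) + s) ^ 2 = (|(n : ℝ) + s| + k) ^ 2 := by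
  have h3 := three_le_abs_cast hn
  rw [abs_le] at hs
  rcases (ne_zero_of_mem_nicfF hn).lt_or_gt with h | h
  · have h' : (n : ℝ) < 0 := by exact_mod_cast h
    rw [abs_of_neg h'] at h3
    rw [Int.sign_eq_neg_one_of_neg h, abs_of_neg (by linarith)]
    push_cast
    ring
  · have h' : (0 : ℝ) < n := by exact_mod_cast h
    rw [abs_of_pos h'] at h3
    rw [Int.sign_eq_one_of_pos h, abs_of_pos (by linarith)]
    push_cast
    ring

lemma nicfRatio_rpow_le_tsum_digitTail {t : ℝ} (ht0 : 0 ≤ t) (ht : t ≤ 1) {n : ℤ}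
    (hn : n ∈ nicfF) {u v : List ℤ} (hu : ∀ b ∈ u, b ∈ nicfF) (hv : ∀ b ∈ v, b ∈ nicfF) :
    nicfRatio (u ++ n :: v) ^ t ≤ ∑' b : digitTail n, nicfRatio (u ++ (b : ℤ) :: v) ^ t := by
  obtain ⟨s, hs, R, hR⟩ := nicfRatio_append_cons hu hv
  set y := |(n : ℝ) + s| with hy
  have hy2 : 2 ≤ y := by
    have h3 := three_le_abs_cast hn
    have h := abs_sub_abs_le_abs_sub (n : ℝ) (-s)
    rw [abs_neg, sub_neg_eq_add] at h
    linarith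
  have hratio : ∀ k : ℕ, nicfRatio (u ++ (n + n.sign * (k + 1 : ℕ)) :: v) =
      nicfRatio (u ++ n :: v) * ENNReal.ofReal (y ^ 2 / (y + (k + 1 : ℕ)) ^ 2) := fun k => by
    rw [hR _ (digitTail_subset hn ⟨k, rfl⟩), hR n hn, digit_add_sign_mul_add_sq hn hs,
      ← sq_abs ((n : ℝ) + s), ← hy, mul_assoc, ← ENNReal.ofReal_mul (by positivity)]
    congr 2
    field_simp
  rw [digitTail, tsum_range (fun b => nicfRatio (u ++ b :: v) ^ t) (digitTail_injective hn)]
  simp only [hratio, ENNReal.mul_rpow_of_nonneg _ _ ht0, ENNReal.tsum_mul_left]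
  refine le_mul_of_one_le_right' ((one_le_tsum_div_add_sq hy2).trans ?_)
  refine ENNReal.tsum_le_tsum fun k => ?_
  have h1 : ENNReal.ofReal (y ^ 2 / (y + (k + 1 : ℕ)) ^ 2) ≤ 1 := by
    rw [ENNReal.ofReal_le_one]
    refine div_le_one_of_le₀ ?_ (by positivity)
    gcongr
    linarith [(k + 1).cast_nonneg (α := ℝ)]
  simpa using ENNReal.rpow_le_rpow_of_exponent_ge h1 ht

/-! ### Codings of the limit set and the upper bound for its dimension -/

/-- The first `n` letters of `ω`. -/
def seqPrefix (ω : ℕ → ℤ) (n : ℕ) : List ℤ := (List.range n).map ω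

/-- The sequence `ω` codes the point `x`. -/
def IsCoding (ω : ℕ → ℤ) (x : ℝ) : Prop :=
  Filter.Tendsto (fun n => nicfComp (seqPrefix ω n) 0) Filter.atTop (nhds x)

lemma seqPrefix_length (ω : ℕ → ℤ) (n : ℕ) : (seqPrefix ω n).length = n := by simp [seqPrefix]

lemma seqPrefix_succ (ω : ℕ → ℤ) (n : ℕ) : seqPrefix ω (n + 1) = seqPrefix ω n ++ [ω n] := by
  simp [seqPrefix, List.range_succ]

lemma seqPrefix_add (ω : ℕ → ℤ) (n k : ℕ) :
    seqPrefix ω (n + k) = seqPrefix ω n ++ seqPrefix (fun i => ω (n + i)) k := by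
  simp [seqPrefix, List.range_add]

lemma seqPrefix_mem {G : Set ℤ} {ω : ℕ → ℤ} (hω : ∀ n, ω n ∈ G) (n : ℕ) :
    seqPrefix ω n ∈ nicfWords G n := by
  refine ⟨seqPrefix_length ω n, fun b hb => ?_⟩
  obtain ⟨k, -, rfl⟩ := List.mem_map.1 hb
  exact hω k

lemma ofReal_two_div_nicfDen_sq (w : List ℤ) :
    ENNReal.ofReal (2 / nicfDen w 0 ^ 2) = 2 * nicfRatio w := by
  rw [nicfRatio, ← ENNReal.ofReal_ofNat, ← ENNReal.ofReal_mul (by norm_num), mul_one_div]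

lemma exists_isCoding {ω : ℕ → ℤ} (hω : ∀ n, ω n ∈ nicfF) : ∃ x, IsCoding ω x := by
  refine cauchySeq_tendsto_of_complete (cauchySeq_of_le_geometric (1 / 4) 2 (by norm_num)
    fun n => ?_)
  have hw := (seqPrefix_mem hω n).2
  have h0 : |(0 : ℝ)| ≤ 2 / 5 := by norm_num
  have h := two_pow_le_abs_nicfDen hw h0
  rw [seqPrefix_succ, nicfComp_append, Real.dist_eq]
  refine (abs_nicfComp_sub_le hw h0 (abs_nicfComp_le (by simpa using hω n) h0)).trans ?_
  rw [one_div_pow, mul_one_div, ← sq_abs]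
  rw [seqPrefix_length] at h
  gcongr
  calc (4 : ℝ) ^ n = (2 ^ n) ^ 2 := by rw [← pow_mul, mul_comm, pow_mul]; norm_num
    _ ≤ _ := by gcongr

/-- The cylinder of the word `w`. -/
noncomputable def nicfCylinder (w : List ℤ) : Set ℝ := nicfComp w '' Set.Icc (-(2 / 5)) (2 / 5)

lemma isClosed_nicfCylinder {w : List ℤ} (hw : ∀ b ∈ w, b ∈ nicfF) :
    IsClosed (nicfCylinder w) := by
  refine (isCompact_Icc.image_of_continuousOn ?_).isClosed
  refine (LipschitzOnWith.of_dist_le_mul (K := 1) fun x hx y hy => ?_).continuousOn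
  have hx' := abs_le.2 hx
  have hy' := abs_le.2 hy
  have h1 := (one_le_pow₀ one_le_two).trans (two_pow_le_abs_nicfDen hw hx')
  have h2 := (one_le_pow₀ one_le_two).trans (two_pow_le_abs_nicfDen hw hy')
  rw [Real.dist_eq, Real.dist_eq, abs_nicfComp_sub hw hx' hy', NNReal.coe_one, one_mul]
  exact div_le_self (abs_nonneg _) (one_le_mul_of_one_le_of_one_le h1 h2)

lemma ediam_nicfCylinder_le {w : List ℤ} (hw : ∀ b ∈ w, b ∈ nicfF) :
    Metric.ediam (nicfCylinder w) ≤ 2 * nicfRatio w := by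
  refine Metric.ediam_le ?_
  rintro _ ⟨x, hx, rfl⟩ _ ⟨y, hy, rfl⟩
  rw [edist_dist, ← ofReal_two_div_nicfDen_sq, Real.dist_eq]
  exact ENNReal.ofReal_le_ofReal (abs_nicfComp_sub_le hw (abs_le.2 hx) (abs_le.2 hy))

lemma IsCoding.mem_nicfCylinder {ω : ℕ → ℤ} (hω : ∀ n, ω n ∈ nicfF) {x : ℝ} (h : IsCoding ω x)
    (n : ℕ) : x ∈ nicfCylinder (seqPrefix ω n) := by
  refine (isClosed_nicfCylinder (seqPrefix_mem hω n).2).mem_of_tendsto h ?_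
  filter_upwards [Filter.eventually_ge_atTop n] with k hk
  obtain ⟨j, rfl⟩ := Nat.exists_eq_add_of_le hk
  rw [seqPrefix_add, nicfComp_append]
  refine Set.mem_image_of_mem _ (abs_le.1 (abs_nicfComp_le ?_ (by norm_num)))
  exact (seqPrefix_mem (fun i => hω (n + i)) j).2

lemma dimH_nicfLimitSet_le {G : Set ℤ} (hG : G ⊆ nicfF) {s : NNReal}
    (h : ∀ m, nicfSum G s m ≤ 2) : dimH (nicfLimitSet G) ≤ s := by
  refine dimH_le fun t ht => ?_
  by_contra! hst
  have hst' : (s : ℝ) < t := by exact_mod_cast hst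
  have hF : ∀ {n} (w : nicfWords G n), ∀ b ∈ w.1, b ∈ nicfF := fun w b hb => hG (w.2.2 b hb)
  have hr : Filter.Tendsto (fun n : ℕ => 2 * (1 / 4 : ℝ≥0∞) ^ n) Filter.atTop (nhds 0) := by
    have := ENNReal.Tendsto.const_mul (a := 2) (ENNReal.tendsto_pow_atTop_nhds_zero_of_lt_one
      (r := 1 / 4) (by simp)) (Or.inr (by simp))
    simpa using this
  have hμ := MeasureTheory.Measure.hausdorffMeasure_le_liminf_tsum (t : ℝ) (nicfLimitSet G)
    (fun n : ℕ => 2 * (1 / 4 : ℝ≥0∞) ^ n) hr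
    (fun n (w : nicfWords G n) => nicfCylinder w)
    (Filter.Eventually.of_forall fun n w => (ediam_nicfCylinder_le (hF w)).trans (by
      gcongr
      exact (nicfRatio_le_pow (hF w)).trans_eq (by rw [w.2.1])))
    (Filter.Eventually.of_forall fun n x hx => by
      obtain ⟨ω, hω, hx⟩ := hx
      exact Set.mem_iUnion.2 ⟨⟨_, seqPrefix_mem hω n⟩,
        IsCoding.mem_nicfCylinder (fun n => hG (hω n)) hx n⟩)
  rw [ht] at hμ
  have hle : ∀ n : ℕ, ∑' w : nicfWords G n, Metric.ediam (nicfCylinder w) ^ (t : ℝ) ≤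
      2 ^ (t : ℝ) * (((1 / 4 : ℝ≥0∞) ^ ((t : ℝ) - s)) ^ n * 2) := fun n => by
    refine le_trans ?_ (mul_le_mul_right (nicfSum_le_of_lt hG hst' h n) _)
    rw [nicfSum, ← wordSum_const_mul]
    refine ENNReal.tsum_le_tsum fun w => ?_
    refine le_of_le_of_eq ?_ (ENNReal.mul_rpow_of_nonneg _ _ t.coe_nonneg)
    exact ENNReal.rpow_le_rpow (ediam_nicfCylinder_le (hF w)) t.coe_nonneg
  have hlim : Filter.Tendsto (fun n : ℕ => (2 : ℝ≥0∞) ^ (t : ℝ) *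
      (((1 / 4 : ℝ≥0∞) ^ ((t : ℝ) - s)) ^ n * 2)) Filter.atTop (nhds 0) := by
    have h1 := ENNReal.tendsto_pow_atTop_nhds_zero_of_lt_one
      (quarter_rpow_lt_one (sub_pos.2 hst'))
    have h2 := ENNReal.Tendsto.mul_const (b := 2) h1 (Or.inr (by simp))
    have h3 := ENNReal.Tendsto.const_mul (a := (2 : ℝ≥0∞) ^ (t : ℝ)) h2
      (Or.inr (ENNReal.rpow_ne_top_of_nonneg t.coe_nonneg (by simp)))
    simpa using h3
  have := hμ.trans (Filter.liminf_le_liminf (Filter.Eventually.of_forall hle))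
  rw [hlim.liminf_eq] at this
  simp at this

/-! ### The lower bound for the dimension over finite alphabets -/

lemma IsCoding.exists_eq_nicfComp {ω : ℕ → ℤ} (hω : ∀ n, ω n ∈ nicfF) {x : ℝ}
    (h : IsCoding ω x) (n : ℕ) :
    ∃ y : ℝ, |y| ≤ 2 / 5 ∧ x = nicfComp (seqPrefix ω n) (1 / ((ω n : ℝ) + y)) := by
  obtain ⟨y, hy, rfl⟩ := h.mem_nicfCylinder hω (n + 1)
  refine ⟨y, abs_le.2 hy, ?_⟩
  rw [seqPrefix_succ, nicfComp_append, nicfComp_cons, nicfComp_nil]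

lemma nicfRatio_seqPrefix_le {ω ω' : ℕ → ℤ} (hω : ∀ n, ω n ∈ nicfF) (hω' : ∀ n, ω' n ∈ nicfF)
    {M : ℝ} (hM : ∀ n, |(ω n : ℝ)| ≤ M) (hM' : ∀ n, |(ω' n : ℝ)| ≤ M) {x x' : ℝ}
    (hx : IsCoding ω x) (hx' : IsCoding ω' x') {n : ℕ} (heq : seqPrefix ω n = seqPrefix ω' n)
    (hne : ω n ≠ ω' n) :
    nicfRatio (seqPrefix ω n) ≤ ENNReal.ofReal (10 * (M + 1) ^ 2) * edist x x' := by
  obtain ⟨y, hy, rfl⟩ := hx.exists_eq_nicfComp hω n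
  obtain ⟨y', hy', rfl⟩ := hx'.exists_eq_nicfComp hω' n
  have hw := (seqPrefix_mem hω n).2
  have hM0 : 0 < M + 1 := by linarith [(abs_nonneg _).trans (hM 0)]
  have hpos := nicfDen_zero_sq_pos hw
  have h1 := le_abs_one_div_digit_sub (hω n) (hω' n) hne (hM n) (hM' n) hy hy'
  have h2 := le_abs_nicfComp_sub hw (abs_one_div_digit_add_le (hω n) hy)
    (abs_one_div_digit_add_le (hω' n) hy')
  rw [← heq, edist_dist, Real.dist_eq, nicfRatio, ← ENNReal.ofReal_mul (by positivity)]
  refine ENNReal.ofReal_le_ofReal ?_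
  calc 1 / nicfDen (seqPrefix ω n) 0 ^ 2
      = 10 * (M + 1) ^ 2 * (1 / 5 / (M + 1) ^ 2 / 2 / nicfDen (seqPrefix ω n) 0 ^ 2) := by
        field_simp
        norm_num
    _ ≤ 10 * (M + 1) ^ 2 * (|1 / ((ω n : ℝ) + y) - 1 / (ω' n + y')| / 2 /
          nicfDen (seqPrefix ω n) 0 ^ 2) := by gcongr
    _ ≤ _ := by gcongr

lemma seqPrefix_congr {ω ω' : ℕ → ℤ} {n : ℕ} (h : ∀ k < n, ω k = ω' k) :
    seqPrefix ω n = seqPrefix ω' n :=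
  List.map_congr_left fun k hk => h k (List.mem_range.1 hk)

lemma exists_nicfRatio_rpow_le {t : ℝ} (ht : 0 < t) {ω : ℕ → ℤ} (hω : ∀ n, ω n ∈ nicfF)
    {ε : ℝ≥0∞} (hε : 0 < ε) : ∃ n, nicfRatio (seqPrefix ω n) ^ t ≤ ε := by
  have hlim := ENNReal.tendsto_pow_atTop_nhds_zero_of_lt_one (quarter_rpow_lt_one ht)
  obtain ⟨n, hn⟩ := (hlim.eventually (ge_mem_nhds hε)).exists
  refine ⟨n, le_trans ?_ hn⟩
  have h := nicfRatio_le_pow (seqPrefix_mem hω n).2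
  rw [seqPrefix_length] at h
  refine (ENNReal.rpow_le_rpow h ht.le).trans_eq ?_
  rw [← ENNReal.rpow_natCast_mul, mul_comm (n : ℝ), ENNReal.rpow_mul_natCast]

/-- Every set of points lies, up to a small error, in one cylinder of comparable size. -/
lemma exists_common_initial_word {A : Set ℤ} (hA : A ⊆ nicfF) (hne : A.Nonempty) {M : ℝ}
    (hM : ∀ b ∈ A, |(b : ℝ)| ≤ M) {t : ℝ} (ht : 0 < t) (U : Set ℝ) {ε : ℝ≥0∞} (hε : 0 < ε) :
    ∃ u : List ℤ, (∀ b ∈ u, b ∈ nicfF) ∧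
      (∀ ω : ℕ → ℤ, (∀ n, ω n ∈ A) → ∀ x ∈ U, IsCoding ω x → seqPrefix ω u.length = u) ∧
      nicfRatio u ^ t ≤ (ENNReal.ofReal (10 * (M + 1) ^ 2) * Metric.ediam U) ^ t + ε := by
  classical
  by_cases hU : ∃ ω : ℕ → ℤ, (∀ n, ω n ∈ A) ∧ ∃ x ∈ U, IsCoding ω x
  · obtain ⟨ω, hω, x, hx, hωx⟩ := hU
    have hωF : ∀ n, ω n ∈ nicfF := fun n => hA (hω n)
    by_cases hS : ∃ n, ∃ ω' : ℕ → ℤ, (∀ n, ω' n ∈ A) ∧ (∃ x ∈ U, IsCoding ω' x) ∧ ω n ≠ ω' n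
    · obtain ⟨ω', hω', ⟨x', hx', hωx'⟩, hdiff⟩ := Nat.find_spec hS
      have hmin : ∀ τ : ℕ → ℤ, (∀ n, τ n ∈ A) → ∀ z ∈ U, IsCoding τ z →
          seqPrefix ω (Nat.find hS) = seqPrefix τ (Nat.find hS) := fun τ hτ z hz hτz =>
        seqPrefix_congr fun k hk => by
          by_contra hk'
          exact Nat.find_min hS hk ⟨τ, hτ, ⟨z, hz, hτz⟩, hk'⟩
      refine ⟨seqPrefix ω (Nat.find hS), (seqPrefix_mem hωF _).2, fun τ hτ z hz hτz => ?_,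
        le_add_right (ENNReal.rpow_le_rpow ?_ ht.le)⟩
      · rw [seqPrefix_length, hmin τ hτ z hz hτz]
      · refine (nicfRatio_seqPrefix_le hωF (fun n => hA (hω' n)) (fun n => hM _ (hω n))
          (fun n => hM _ (hω' n)) hωx hωx' (hmin ω' hω' x' hx' hωx') hdiff).trans ?_
        gcongr
        exact Metric.edist_le_ediam_of_mem hx hx'
    · push Not at hS
      obtain ⟨n, hn⟩ := exists_nicfRatio_rpow_le ht hωF hε
      refine ⟨seqPrefix ω n, (seqPrefix_mem hωF n).2, fun τ hτ z hz hτz => ?_,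
        le_add_left hn⟩
      rw [seqPrefix_length]
      exact seqPrefix_congr fun k _ => (hS k τ hτ ⟨z, hz, hτz⟩).symm
  · obtain ⟨a, ha⟩ := hne
    obtain ⟨n, hn⟩ := exists_nicfRatio_rpow_le ht (fun _ : ℕ => hA ha) hε
    refine ⟨_, (seqPrefix_mem (fun _ : ℕ => hA ha) n).2, fun τ hτ z hz hτz => ?_,
      le_add_left hn⟩
    exact absurd ⟨τ, hτ, z, hz, hτz⟩ hU

lemma seqPrefix_eq_ofFn (ω : ℕ → ℤ) (n : ℕ) : seqPrefix ω n = List.ofFn fun i : Fin n => ω i :=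
  List.ext_getElem (by simp [seqPrefix]) fun i _ _ => by simp [seqPrefix]

/-- A set of words meeting every sequence over a finite alphabet does so at bounded depth. -/
lemma exists_depth_bound {A : Set ℤ} (hA : A.Finite) {W : Set (List ℤ)}
    (hW : ∀ ω : ℕ → ℤ, (∀ n, ω n ∈ A) → ∃ n, seqPrefix ω n ∈ W) :
    ∃ N, ∀ ω : ℕ → ℤ, (∀ n, ω n ∈ A) → ∃ n ≤ N, seqPrefix ω n ∈ W := by
  have hopen : ∀ N : ℕ, IsOpen {ω : ℕ → ℤ | ∃ n ≤ N, seqPrefix ω n ∈ W} := fun N => by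
    have : {ω : ℕ → ℤ | ∃ n ≤ N, seqPrefix ω n ∈ W} = ⋃ n, ⋃ _ : n ≤ N,
        (fun (ω : ℕ → ℤ) (i : Fin n) => ω i) ⁻¹' {g | List.ofFn g ∈ W} := by
      ext ω
      simp [seqPrefix_eq_ofFn]
    rw [this]
    exact isOpen_iUnion fun n => isOpen_iUnion fun _ =>
      (isOpen_discrete _).preimage (by fun_prop)
  have hcomp : IsCompact (Set.univ.pi fun _ : ℕ => A) := isCompact_univ_pi fun _ => hA.isCompact
  obtain ⟨N, hN⟩ := hcomp.elim_directed_cover _ hopen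
    (fun ω hω => by
      obtain ⟨n, hn⟩ := hW ω fun k => hω k (Set.mem_univ k)
      exact Set.mem_iUnion.2 ⟨n, n, le_rfl, hn⟩)
    (Monotone.directed_le fun N N' hNN ω ⟨n, hn, hω⟩ => ⟨n, hn.trans hNN, hω⟩)
  exact ⟨N, fun ω hω => hN fun k _ => hω k⟩

lemma nicfSum_ne_top {A : Set ℤ} (hA : A.Finite) {t : ℝ} (ht : 0 ≤ t) (m : ℕ) :
    nicfSum A t m ≠ ∞ := by
  have key : ∀ f : List ℤ → ℝ≥0∞, (∀ w, f w ≠ ∞) → wordSum A m f ≠ ∞ := by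
    induction m with
    | zero => exact fun f hf => by rw [wordSum_zero]; exact hf []
    | succ m ih =>
      intro f hf
      have := hA.to_subtype
      have := Fintype.ofFinite A
      rw [wordSum_succ, tsum_fintype]
      exact ENNReal.sum_ne_top.2 fun b _ => ih _ fun w => hf _
  exact key _ fun w => ENNReal.rpow_ne_top_of_nonneg ht (nicfRatio_ne_top w)

/-- If the words over `A` of length more than `N` start with words `u i` of small total weight,
then the partition sums are bounded. -/
lemma nicfSum_le_sum_range {A : Set ℤ} (hA : A ⊆ nicfF) {t : ℝ} (ht0 : 0 ≤ t) (ht : t ≤ 1)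
    {u : ℕ → List ℤ} (hu : ∀ i, ∀ b ∈ u i, b ∈ nicfF) (hne : ∀ i, u i ≠ [])
    (hsum : 2 * ∑' i, nicfRatio (u i) ^ t ≤ 1) {N : ℕ}
    (hN : ∀ m > N, ∀ w ∈ nicfWords A m, ∃ i, u i <+: w) (m : ℕ) :
    nicfSum A t m ≤ ∑ j ∈ Finset.range (N + 1), nicfSum A t j := by
  induction m using Nat.strong_induction_on with
  | _ m ih =>
    rcases Nat.lt_or_ge m (N + 1) with hm | hm
    · exact Finset.single_le_sum (f := fun j => nicfSum A t j) (fun _ _ => zero_le)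
        (Finset.mem_range.2 hm)
    choose i hi using fun w : nicfWords A m => hN m hm w w.2
    choose v hv using hi
    have hvmem : ∀ w, v w ∈ nicfWords A (m - (u (i w)).length) := fun w => by
      have hlen := congrArg List.length (hv w)
      rw [List.length_append, w.2.1] at hlen
      refine ⟨by lia, fun b hb => w.2.2 b ?_⟩
      rw [← hv w]
      exact List.mem_append_right _ hb
    let e : nicfWords A m → Σ i, nicfWords A (m - (u i).length) := fun w => ⟨i w, v w, hvmem w⟩
    have he : ∀ w, u (e w).1 ++ (e w).2.1 = w := hv
    have hinj : Function.Injective e := fun w w' h => Subtype.ext (by rw [← he w, ← he w', h])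
    calc nicfSum A t m
        = ∑' w : nicfWords A m, nicfRatio (u (e w).1 ++ (e w).2.1) ^ t := by simp only [he]; rfl
      _ ≤ ∑' p : Σ i, nicfWords A (m - (u i).length), nicfRatio (u p.1 ++ p.2.1) ^ t :=
          ENNReal.tsum_comp_le_tsum_of_injective hinj fun p => nicfRatio (u p.1 ++ p.2.1) ^ t
      _ = ∑' i, wordSum A (m - (u i).length) fun v => nicfRatio (u i ++ v) ^ t :=
          ENNReal.tsum_sigma' _
      _ ≤ ∑' i, 2 * nicfRatio (u i) ^ t * ∑ j ∈ Finset.range (N + 1), nicfSum A t j := by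
          refine ENNReal.tsum_le_tsum fun i => ?_
          have hpos := List.length_pos_iff.2 (hne i)
          refine le_trans ?_ (mul_le_mul_right (ih (m - (u i).length) (by lia)) _)
          rw [nicfSum, ← wordSum_const_mul]
          refine wordSum_le fun v hv => ?_
          rw [mul_assoc]
          exact nicfRatio_append_rpow_le ht0 ht (hu i) fun b hb => hA (hv.2 b hb)
      _ = (2 * ∑' i, nicfRatio (u i) ^ t) * ∑ j ∈ Finset.range (N + 1), nicfSum A t j := by
          rw [ENNReal.tsum_mul_right, ENNReal.tsum_mul_left]
      _ ≤ _ := by simpa using mul_le_mul_left hsum (∑ j ∈ Finset.range (N + 1), nicfSum A t j)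

lemma nicfSum_le_two_of_hausdorffMeasure_eq_zero {A : Set ℤ} (hA : A ⊆ nicfF) (hfin : A.Finite)
    {t : ℝ} (ht0 : 0 < t) (ht : t ≤ 1)
    (hμ : MeasureTheory.Measure.hausdorffMeasure t (nicfLimitSet A) = 0) (m : ℕ) :
    nicfSum A t m ≤ 2 := by
  rcases A.eq_empty_or_nonempty with rfl | hne
  · refine nicfSum_le_two hA ht0.le ht ENNReal.one_ne_top (fun m => ?_) m
    cases m with
    | zero => rw [nicfSum_zero]
    | succ m => simp [nicfSum, wordSum_succ]
  obtain ⟨M, hM⟩ : ∃ M : ℝ, ∀ b ∈ A, |(b : ℝ)| ≤ M := by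
    obtain ⟨M, hM⟩ := (hfin.image fun b : ℤ => |(b : ℝ)|).bddAbove
    exact ⟨M, fun b hb => hM (Set.mem_image_of_mem _ hb)⟩
  set C := ENNReal.ofReal (10 * (M + 1) ^ 2)
  have hC : C ^ t ≠ ∞ := ENNReal.rpow_ne_top_of_nonneg ht0.le ENNReal.ofReal_ne_top
  obtain ⟨T, hcov, hT⟩ : ∃ T : ℕ → Set ℝ, nicfLimitSet A ⊆ ⋃ i, T i ∧
      ∑' i, (⨆ _ : (T i).Nonempty, Metric.ediam (T i) ^ t) < 1 / 4 / 2 / C ^ t := by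
    rw [MeasureTheory.Measure.hausdorffMeasure_apply, ← nonpos_iff_eq_zero, iSup₂_le_iff] at hμ
    have h := (hμ ∞ (by simp)).trans_lt
      (ENNReal.div_pos (a := 1 / 4 / 2) (b := C ^ t) (by simp) hC)
    simp only [iInf_lt_iff] at h
    obtain ⟨T, hcov, -, hT⟩ := h
    exact ⟨T, hcov, hT⟩
  obtain ⟨ε, hε, hεsum⟩ := ENNReal.exists_pos_sum_of_countable' (ε := 1 / 4 / 2) (by simp) ℕ
  choose u huF hucode huε using fun i => exists_common_initial_word hA hne hM ht0 (T i) (hε i)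
  have hsum : ∑' i, nicfRatio (u i) ^ t ≤ 1 / 4 := by
    calc ∑' i, nicfRatio (u i) ^ t
        ≤ ∑' i, (C ^ t * (⨆ _ : (T i).Nonempty, Metric.ediam (T i) ^ t) + ε i) := by
          refine ENNReal.tsum_le_tsum fun i => (huε i).trans ?_
          rw [ENNReal.mul_rpow_of_nonneg _ _ ht0.le]
          gcongr
          rcases (T i).eq_empty_or_nonempty with h | h
          · simp [h, ht0]
          · exact le_iSup (fun _ : (T i).Nonempty => Metric.ediam (T i) ^ t) h
      _ ≤ C ^ t * (1 / 4 / 2 / C ^ t) + 1 / 4 / 2 := by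
          rw [ENNReal.tsum_add, ENNReal.tsum_mul_left]
          gcongr
      _ ≤ 1 / 4 / 2 + 1 / 4 / 2 := by
          gcongr
          exact ENNReal.mul_div_le
      _ = 1 / 4 := ENNReal.add_halves _
  have hsum' : 2 * ∑' i, nicfRatio (u i) ^ t ≤ 1 := by
    calc 2 * ∑' i, nicfRatio (u i) ^ t ≤ 4 * (1 / 4) := by gcongr; norm_num
      _ ≤ 1 := ENNReal.mul_div_le
  have hune : ∀ i, u i ≠ [] := fun i hi => by
    have h1 := (ENNReal.le_tsum i).trans hsum
    rw [hi, nicfRatio_nil, ENNReal.one_rpow] at h1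
    have h2 : (1 / 4 : ℝ≥0∞) < 1 := by simp
    exact h1.not_gt h2
  obtain ⟨N, hN⟩ := exists_depth_bound hfin (W := Set.range u) fun ω hω => by
    obtain ⟨x, hx⟩ := exists_isCoding fun n => hA (hω n)
    obtain ⟨i, hi⟩ := Set.mem_iUnion.1 (hcov (show x ∈ nicfLimitSet A from ⟨ω, hω, hx⟩))
    exact ⟨_, i, (hucode i ω hω x hi hx).symm⟩
  refine nicfSum_le_two hA ht0.le ht
    (ENNReal.sum_ne_top.2 fun j _ => nicfSum_ne_top hfin ht0.le j)
    (nicfSum_le_sum_range hA ht0.le ht huF hune hsum' (N := N) fun k hk w hw => ?_) m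
  obtain ⟨a, ha⟩ := hne
  have hext : seqPrefix (fun n => w.getD n a) k = w := by
    rw [seqPrefix_eq_ofFn]
    refine List.ext_getElem (by simp [hw.1]) fun i _ _ => by simp_all
  obtain ⟨n, hn, i, hi⟩ := hN (fun n => w.getD n a) fun n => by
    rcases Nat.lt_or_ge n w.length with h | h
    · simpa [h] using hw.2 _ (List.getElem_mem h)
    · simpa [h] using ha
  obtain ⟨j, rfl⟩ := Nat.exists_eq_add_of_le (hn.trans (le_of_lt hk))
  exact ⟨i, _, by rw [hi]; exact (seqPrefix_add _ n j).symm.trans hext⟩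

/-! ### Greedy subalphabets -/

lemma nicfLimitSet_mono {G H : Set ℤ} (h : G ⊆ H) : nicfLimitSet G ⊆ nicfLimitSet H :=
  fun _ ⟨ω, hω, hx⟩ => ⟨ω, fun n => h (hω n), hx⟩

/-- An injective coding of the integers along which the absolute value is nondecreasing. -/
def digitCode (b : ℤ) : ℕ := 2 * b.natAbs + if b < 0 then 1 else 0

lemma digitCode_injective : Function.Injective digitCode := fun a b h => by
  unfold digitCode at h
  split_ifs at h <;> lia

lemma digitCode_lt_of_abs_lt {a b : ℤ} (h : |a| < |b|) : digitCode a < digitCode b := by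
  rw [Int.abs_eq_natAbs, Int.abs_eq_natAbs] at h
  unfold digitCode
  split_ifs <;> lia

lemma exists_greedy_set (P : Set ℤ → Prop) :
    ∃ G : Set ℤ, ∀ b, b ∈ G ↔ P (insert b {a ∈ G | digitCode a < digitCode b}) := by
  let wf : WellFounded fun a b : ℤ => digitCode a < digitCode b :=
    InvImage.wf digitCode wellFounded_lt
  let step (b : ℤ) (ih : ∀ a, digitCode a < digitCode b → Prop) : Prop :=
    P (insert b {a | ∃ h : digitCode a < digitCode b, ih a h})
  refine ⟨{b | wf.fix step b}, fun b => ?_⟩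
  have h := wf.fix_eq step b
  change wf.fix step b ↔ _
  rw [h]
  have hset : {a | ∃ _ : digitCode a < digitCode b, wf.fix step a} =
      {a ∈ {b | wf.fix step b} | digitCode a < digitCode b} := by
    ext a
    exact ⟨fun ⟨h1, h2⟩ => ⟨h2, h1⟩, fun ⟨h1, h2⟩ => ⟨h2, h1⟩⟩
  rw [← hset]

lemma nicfSum_le_two_of_dimH_lt {G : Set ℤ} (hG : G ⊆ nicfF) {s : NNReal} (hs0 : 0 < s)
    (hs : s ≤ 1) (h : dimH (nicfLimitSet G) < s) (m : ℕ) : nicfSum G s m ≤ 2 :=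
  nicfSum_le_of_finite fun _ hA hfin =>
    nicfSum_le_two_of_hausdorffMeasure_eq_zero (hA.trans hG) hfin (NNReal.coe_pos.2 hs0)
      (by exact_mod_cast hs)
      (hausdorffMeasure_of_dimH_lt ((dimH_mono (nicfLimitSet_mono hA)).trans_lt h)) m

lemma finite_digits_of_le_nicfRatio {t : ℝ} (ht : 0 < t) {c : ℝ≥0∞} (hc : c ≠ 0) :
    {n : ℤ | c ≤ nicfRatio [n] ^ t}.Finite := by
  have hlim : Filter.Tendsto (fun n : ℤ => nicfRatio [n] ^ t) Filter.cofinite (nhds 0) := by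
    have hsum := (Real.summable_one_div_int_pow (p := 2)).2 one_lt_two
    have h := ((ENNReal.continuous_rpow_const (y := t)).tendsto 0).comp
      (ENNReal.ofReal_zero ▸ ENNReal.tendsto_ofReal hsum.tendsto_cofinite_zero)
    rw [ENNReal.zero_rpow_of_pos ht] at h
    exact h.congr fun n => by rw [nicfRatio_singleton, Function.comp_apply]
  have h := Filter.eventually_cofinite.1 (hlim.eventually (gt_mem_nhds (pos_iff_ne_zero.2 hc)))
  simpa only [not_lt] using h

/-- If some digit is missing but only finitely many are, the last missing digit could have been
chosen instead of the digits behind it. -/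
lemma nicfSum_insert_initial_le {G : Set ℤ} (hG : G ⊆ nicfF) {t : ℝ} (ht0 : 0 ≤ t) (ht : t ≤ 1)
    {n : ℤ} (hn : n ∈ nicfF) (htail : digitTail n ⊆ G) (m : ℕ) :
    nicfSum (insert n {a ∈ G | digitCode a < digitCode n}) t m ≤ nicfSum G t m := by
  refine wordSum_insert_le hG (fun a ha => ha.1) htail ?_ hn m _ fun u v hu hv =>
    nicfRatio_rpow_le_tsum_digitTail ht0 ht hn hu hv
  refine Set.disjoint_left.2 fun a ha ha' => ?_
  exact ha.2.not_gt (digitCode_lt_of_abs_lt (abs_lt_of_mem_digitTail hn ha'))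

lemma exists_dimH_nicfLimitSet_eq {t : NNReal} (ht : t ≤ 1)
    (htF : (t : ℝ≥0∞) ≤ dimH (nicfLimitSet nicfF)) :
    ∃ G ⊆ nicfF, dimH (nicfLimitSet G) = t := by
  have ht1 : (t : ℝ) ≤ 1 := by exact_mod_cast ht
  obtain ⟨G, hGmem⟩ := exists_greedy_set fun A => A ⊆ nicfF ∧ ∀ m, nicfSum A t m ≤ 2
  have hG : G ⊆ nicfF := fun b hb => ((hGmem b).1 hb).1 (Set.mem_insert _ _)
  have homit : ∀ n ∈ nicfF, n ∉ G →
      ¬ ∀ m, nicfSum (insert n {a ∈ G | digitCode a < digitCode n}) t m ≤ 2 :=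
    fun n hn hnG h => hnG ((hGmem n).2 ⟨Set.insert_subset hn fun a ha => hG ha.1, h⟩)
  have hbdd : ∀ m, nicfSum G t m ≤ 2 := fun m => nicfSum_le_of_finite fun A hA hfin => by
    rcases A.eq_empty_or_nonempty with rfl | hne
    · cases m with
      | zero => rw [nicfSum_zero]; exact one_le_two
      | succ m => simp [nicfSum, wordSum_succ]
    obtain ⟨n, hn, hmax⟩ := Set.exists_max_image A digitCode hfin hne
    refine (wordSum_mono_set (fun a ha => ?_) m _).trans (((hGmem n).1 (hA hn)).2 m)
    rcases (hmax a ha).lt_or_eq with h | h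
    · exact Or.inr ⟨hA ha, h⟩
    · exact Or.inl (digitCode_injective h)
  have hle := dimH_nicfLimitSet_le hG hbdd
  refine ⟨G, hG, le_antisymm hle ?_⟩
  by_contra! hlt
  rcases (nicfF \ G).finite_or_infinite with hfin | hinf
  · rcases (nicfF \ G).eq_empty_or_nonempty with hempty | hne
    · rw [hG.antisymm (Set.sdiff_eq_empty.1 hempty)] at hlt
      exact hlt.not_ge htF
    · obtain ⟨n, hn, hmax⟩ := Set.exists_max_image _ digitCode hfin hne
      refine homit n hn.1 hn.2 fun m =>
        (nicfSum_insert_initial_le hG t.coe_nonneg ht1 hn.1 (fun b hb => ?_) m).trans (hbdd m)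
      by_contra hbG
      exact (hmax b ⟨digitTail_subset hn.1 hb, hbG⟩).not_gt
        (digitCode_lt_of_abs_lt (abs_lt_of_mem_digitTail hn.1 hb))
  · obtain ⟨s, hs, hst⟩ := ENNReal.lt_iff_exists_nnreal_btwn.1 hlt
    have hst' : s < t := by exact_mod_cast hst
    have hs0 : 0 < s := by
      have := (zero_le (a := dimH (nicfLimitSet G))).trans_lt hs
      exact_mod_cast this
    have ht0 : (0 : ℝ) < t := NNReal.coe_pos.2 (hs0.trans hst')
    have hZ := totalSum_ne_top_of_lt hG (NNReal.coe_lt_coe.2 hst')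
      (nicfSum_le_two_of_dimH_lt hG hs0 (hst'.le.trans ht) hs)
    set Z := totalSum G fun w => nicfRatio w ^ (t : ℝ)
    have h8 : 8 * Z ≠ ∞ := ENNReal.mul_ne_top (by simp) hZ
    obtain ⟨n, hn, hsmall⟩ := (hinf.sdiff (finite_digits_of_le_nicfRatio ht0
      (ENNReal.inv_ne_zero.2 h8))).nonempty
    refine homit n hn.1 hn.2 fun m => (wordSum_mono_set ?_ m _).trans
      (nicfSum_insert_le_two hG ht0.le ht1 hn.1 hZ ?_ m)
    · exact Set.insert_subset_insert fun a ha => ha.1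
    · have h := mul_le_mul_right (not_le.1 hsmall).le (8 * Z)
      calc Z * (8 * nicfRatio [n] ^ (t : ℝ)) = 8 * Z * nicfRatio [n] ^ (t : ℝ) := by ring
        _ ≤ 8 * Z * (8 * Z)⁻¹ := h
        _ ≤ 1 := ENNReal.mul_inv_le_one _

/-- Theorem 1.1: the NICF system restricted to digits of absolute value at least 3 has
full Hausdorff dimension spectrum: {dim_H(J_G) : G ⊆ F} = [0, dim_H(J_F)]. -/
theorem nicf_full_dimension_spectrum :
    {d : ℝ≥0∞ | ∃ G : Set ℤ, G ⊆ nicfF ∧ dimH (nicfLimitSet G) = d}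
      = Set.Icc 0 (dimH (nicfLimitSet nicfF)) := by
  ext d
  constructor
  · rintro ⟨G, hG, rfl⟩
    exact ⟨zero_le, dimH_mono (nicfLimitSet_mono hG)⟩
  · rintro ⟨-, hd⟩
    have hd1 : d ≤ 1 := hd.trans
      ((dimH_mono (Set.subset_univ _)).trans_eq Real.dimH_univ)
    lift d to NNReal using ne_top_of_le_ne_top ENNReal.one_ne_top hd1
    obtain ⟨G, hG, h⟩ := exists_dimH_nicfLimitSet_eq (by exact_mod_cast hd1) hd
    exact ⟨G, hG, h⟩
end
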